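/- Let n ≥ 1, s_L > 0, and d > 0. Let V : ℝⁿ → ℝⁿ be a smooth ℤⁿ-periodic divergence-free vector field and P ∈ ℝⁿ. Let u₁, u₂, w₁, w₂ : ℝⁿ → ℝ be smooth ℤⁿ-periodic functions with ∫_{[0,1]ⁿ} w₁ dx = ∫_{[0,1]ⁿ} w₂ dx = 0, and let H₁, H₂ ∈ ℝ be constants such that −d·s_L·Δwᵢ(x) + V(x)·∇wᵢ(x) = Hᵢ − s_L|P + ∇uᵢ(x)| − V(x)·P holds for all x ∈ ℝⁿ and i = 1,2. Then (∫_{[0,1]ⁿ} ‖∇w₁ − ∇w₂‖² dx)^{1/2} ≤ (√n/(π d)) · (∫_{[0,1]ⁿ} ‖∇u₁ − ∇u₂‖² dx)^{1/2}. -/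

import Mathlib

open MeasureTheory Real
open scoped RealInnerProductSpace

noncomputable section

/-- The unit cube `[0,1]ⁿ` in `ℝⁿ`. -/
def cube (n : ℕ) : Set (EuclideanSpace ℝ (Fin n)) :=
  {x | ∀ i, x i ∈ Set.Icc (0:ℝ) 1}

/-- A function on `ℝⁿ` is `ℤⁿ`-periodic if it is invariant under integer translations. -/
def IsZnPeriodic {n : ℕ} {F : Type*} (f : EuclideanSpace ℝ (Fin n) → F) : Prop :=
  ∀ (x : EuclideanSpace ℝ (Fin n)) (z : Fin n → ℤ),
    f (x + (WithLp.equiv 2 (Fin n → ℝ)).symm fun i => (z i : ℝ)) = f x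

/-- The divergence of a vector field: the trace of its Fréchet derivative. -/
def diverg {n : ℕ} (V : EuclideanSpace ℝ (Fin n) → EuclideanSpace ℝ (Fin n))
    (x : EuclideanSpace ℝ (Fin n)) : ℝ :=
  LinearMap.trace ℝ (EuclideanSpace ℝ (Fin n)) (fderiv ℝ V x).toLinearMap

/-- The Laplacian of a scalar function: the divergence of its gradient. -/
def laplacian {n : ℕ} (f : EuclideanSpace ℝ (Fin n) → ℝ)
    (x : EuclideanSpace ℝ (Fin n)) : ℝ :=
  diverg (gradient f) x

/-! ### Integration of periodic functions over the unit cube -/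

theorem cube_eq_preimage (n : ℕ) :
    cube n = (MeasurableEquiv.toLp 2 (Fin n → ℝ)).symm ⁻¹' Set.Icc 0 1 := by
  ext x
  simp [cube, Pi.le_def, forall_and]

theorem measurableSet_cube (n : ℕ) : MeasurableSet (cube n) := by
  rw [cube_eq_preimage]
  exact (MeasurableEquiv.toLp 2 (Fin n → ℝ)).symm.measurable measurableSet_Icc

theorem isCompact_cube (n : ℕ) : IsCompact (cube n) := by
  have h : cube n = (EuclideanSpace.equiv (Fin n) ℝ).toHomeomorph ⁻¹' Set.Icc 0 1 := by
    ext x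
    simp [cube, Pi.le_def, forall_and]
  rw [h]
  exact ((EuclideanSpace.equiv (Fin n) ℝ).toHomeomorph.isCompact_preimage).2 isCompact_Icc

theorem setIntegral_cube_comp_ofLp {n : ℕ} (g : (Fin n → ℝ) → ℝ) :
    ∫ x in cube n, g ((MeasurableEquiv.toLp 2 (Fin n → ℝ)).symm x) =
      ∫ y in Set.Icc (0 : Fin n → ℝ) 1, g y := by
  rw [cube_eq_preimage]
  exact (EuclideanSpace.volume_preserving_symm_measurableEquiv_toLp (Fin n)).setIntegral_preimage_emb
    (MeasurableEquiv.measurableEmbedding _) g _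

theorem volume_cube (n : ℕ) : volume (cube n) = 1 := by
  rw [cube_eq_preimage,
    (EuclideanSpace.volume_preserving_symm_measurableEquiv_toLp (Fin n)).measure_preimage
      measurableSet_Icc.nullMeasurableSet]
  simp [Real.volume_Icc_pi]

theorem setIntegral_cube_const (n : ℕ) (c : ℝ) : ∫ _ in cube n, c = c := by
  simp [Measure.real, volume_cube]

theorem fundamentalDomain_ae_eq_cube (n : ℕ) :
    ZSpan.fundamentalDomain (EuclideanSpace.basisFun (Fin n) ℝ).toBasis =ᵐ[volume] cube n := by
  have h : ZSpan.fundamentalDomain (EuclideanSpace.basisFun (Fin n) ℝ).toBasis =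
      (MeasurableEquiv.toLp 2 (Fin n → ℝ)).symm ⁻¹'
        (Set.univ.pi fun i => Set.Ico ((0 : Fin n → ℝ) i) ((1 : Fin n → ℝ) i)) := by
    ext x
    simp [ZSpan.mem_fundamentalDomain]
  rw [h, cube_eq_preimage]
  exact (EuclideanSpace.volume_preserving_symm_measurableEquiv_toLp
    (Fin n)).quasiMeasurePreserving.preimage_ae_eq Measure.univ_pi_Ico_ae_eq_Icc

theorem IsZnPeriodic.setIntegral_cube_add {n : ℕ} {f : EuclideanSpace ℝ (Fin n) → ℝ}
    (hf : IsZnPeriodic f) (v : EuclideanSpace ℝ (Fin n)) :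
    ∫ x in cube n, f (v + x) = ∫ x in cube n, f x := by
  set b := (EuclideanSpace.basisFun (Fin n) ℝ).toBasis
  have hD := ZSpan.isAddFundamentalDomain' b volume
  have hinv : ∀ (g : (Submodule.span ℤ (Set.range b)).toAddSubgroup) (x : EuclideanSpace ℝ (Fin n)),
      f (g +ᵥ x) = f x := by
    rintro ⟨g, hg⟩ x
    rw [Submodule.mem_toAddSubgroup, b.mem_span_iff_repr_mem ℤ] at hg
    choose z hz using hg
    have hgz : g = (WithLp.equiv 2 (Fin n → ℝ)).symm fun i => (z i : ℝ) := by
      ext i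
      simpa [b] using (hz i).symm
    have := hf x z
    rw [← hgz, add_comm] at this
    exact this
  have : Countable (Submodule.span ℤ (Set.range b)).toAddSubgroup :=
    inferInstanceAs (Countable (Submodule.span ℤ (Set.range b)))
  have h1 := (hD.vadd_of_comm v).setIntegral_eq hD hinv
  have h2 := (measurePreserving_add_left volume v).setIntegral_image_emb
    (MeasurableEquiv.addLeft v).measurableEmbedding f (ZSpan.fundamentalDomain b)
  rw [← setIntegral_congr_set (fundamentalDomain_ae_eq_cube n),
    ← setIntegral_congr_set (fundamentalDomain_ae_eq_cube n), ← h2]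
  exact h1

theorem integrableOn_cube {n : ℕ} {f : EuclideanSpace ℝ (Fin n) → ℝ} (hf : Continuous f) :
    IntegrableOn f (cube n) :=
  hf.continuousOn.integrableOn_compact (isCompact_cube n)

theorem setIntegral_setIntegral_swap_of_isCompact {X Y : Type*} [TopologicalSpace X]
    [TopologicalSpace Y] [T2Space X] [T2Space Y] [SecondCountableTopology X]
    [SecondCountableTopology Y] [MeasurableSpace X] [MeasurableSpace Y] [BorelSpace X]
    [BorelSpace Y] {μ : Measure X} {ν : Measure Y} [SFinite μ] [SFinite ν]
    [IsFiniteMeasureOnCompacts μ] [IsFiniteMeasureOnCompacts ν] {s : Set X} {t : Set Y}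
    (hs : IsCompact s) (ht : IsCompact t) {f : X → Y → ℝ}
    (hf : Continuous (Function.uncurry f)) :
    ∫ x in s, ∫ y in t, f x y ∂ν ∂μ = ∫ y in t, ∫ x in s, f x y ∂μ ∂ν := by
  apply integral_integral_swap
  have := isFiniteMeasure_restrict.2 (hs.measure_lt_top (μ := μ)).ne
  have := isFiniteMeasure_restrict.2 (ht.measure_lt_top (μ := ν)).ne
  obtain ⟨C, hC⟩ := (hs.prod ht).exists_bound_of_continuousOn hf.continuousOn
  refine Integrable.of_bound hf.aestronglyMeasurable C ?_
  rw [Measure.prod_restrict]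
  exact ae_restrict_of_forall_mem (hs.measurableSet.prod ht.measurableSet) hC

theorem continuous_setIntegral_cube {X : Type*} [TopologicalSpace X] [FirstCountableTopology X]
    [LocallyCompactSpace X] {n : ℕ} {f : X → EuclideanSpace ℝ (Fin n) → ℝ}
    (hf : Continuous (Function.uncurry f)) : Continuous fun x => ∫ y in cube n, f x y :=
  continuous_parametric_integral_of_continuous hf (isCompact_cube n)

/-! ### Derivatives of periodic functions and the divergence theorem -/

theorem IsZnPeriodic.fderiv {n : ℕ} {F : Type*} [NormedAddCommGroup F] [NormedSpace ℝ F]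
    {f : EuclideanSpace ℝ (Fin n) → F} (hf : IsZnPeriodic f) : IsZnPeriodic (fderiv ℝ f) := by
  intro x z
  rw [← fderiv_comp_add_right]
  congr 1
  funext y
  exact hf y z

theorem IsZnPeriodic.gradient {n : ℕ} {f : EuclideanSpace ℝ (Fin n) → ℝ} (hf : IsZnPeriodic f) :
    IsZnPeriodic (gradient f) := by
  intro x z
  simp only [_root_.gradient, hf.fderiv x z]

theorem sub_eq_setIntegral_fderiv {n : ℕ} {f : EuclideanSpace ℝ (Fin n) → ℝ}
    (hf : ContDiff ℝ 1 f) (x v : EuclideanSpace ℝ (Fin n)) :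
    f (x + v) - f x = ∫ s in Set.Icc (0 : ℝ) 1, fderiv ℝ f (s • v + x) v := by
  rw [integral_Icc_eq_integral_Ioc, ← intervalIntegral.integral_of_le zero_le_one,
    intervalIntegral.integral_eq_sub_of_hasDerivAt (f := fun s : ℝ => f (s • v + x))]
  · simp [add_comm]
  · intro s _
    have h1 : HasDerivAt (fun s : ℝ => s • v + x) v s := by
      simpa using ((hasDerivAt_id s).smul_const v).add_const x
    exact (hf.differentiable one_ne_zero _).hasFDerivAt.comp_hasDerivAt s h1
  · have := hf.continuous_fderiv one_ne_zero
    exact Continuous.intervalIntegrable (by fun_prop) _ _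

theorem IsZnPeriodic.setIntegral_cube_fderiv_apply {n : ℕ} {f : EuclideanSpace ℝ (Fin n) → ℝ}
    (hf : IsZnPeriodic f) (hfc : ContDiff ℝ 1 f) (i : Fin n) :
    ∫ x in cube n, _root_.fderiv ℝ f x (EuclideanSpace.single i 1) = 0 := by
  set v : EuclideanSpace ℝ (Fin n) := EuclideanSpace.single i 1 with hv
  have hc := hfc.continuous_fderiv one_ne_zero
  have hper : IsZnPeriodic fun x => _root_.fderiv ℝ f x v := fun x z => by
    simp only [hf.fderiv x z]
  have hzero : ∀ x, ∫ s in Set.Icc (0 : ℝ) 1, _root_.fderiv ℝ f (s • v + x) v = 0 := by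
    intro x
    rw [← sub_eq_setIntegral_fderiv hfc, sub_eq_zero]
    convert hf x (Pi.single i 1) using 3
    ext j
    by_cases h : j = i <;> simp [hv, h, Pi.single_apply]
  have hswap := setIntegral_setIntegral_swap_of_isCompact (μ := volume) (ν := volume)
    (isCompact_Icc (a := (0 : ℝ)) (b := 1)) (isCompact_cube n)
    (f := fun s x => _root_.fderiv ℝ f (s • v + x) v)
    (by simp only [Function.uncurry_def]; fun_prop)
  simp only [hzero, integral_zero, hper.setIntegral_cube_add] at hswap
  simpa using hswap

theorem diverg_eq_sum {n : ℕ} {F : EuclideanSpace ℝ (Fin n) → EuclideanSpace ℝ (Fin n)}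
    (x : EuclideanSpace ℝ (Fin n)) (hF : DifferentiableAt ℝ F x) :
    diverg F x = ∑ i, fderiv ℝ (fun y => F y i) x (EuclideanSpace.single i 1) := by
  rw [diverg, LinearMap.trace_eq_sum_inner _ (EuclideanSpace.basisFun (Fin n) ℝ)]
  refine Finset.sum_congr rfl fun i _ => ?_
  have h : HasFDerivAt (fun y => F y i)
      ((EuclideanSpace.proj i : EuclideanSpace ℝ (Fin n) →L[ℝ] ℝ).comp (fderiv ℝ F x)) x :=
    (EuclideanSpace.proj i : EuclideanSpace ℝ (Fin n) →L[ℝ] ℝ).hasFDerivAt.comp x hF.hasFDerivAt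
  rw [h.fderiv]
  simp [EuclideanSpace.inner_single_left]

theorem continuous_diverg {n : ℕ} {F : EuclideanSpace ℝ (Fin n) → EuclideanSpace ℝ (Fin n)}
    (hF : ContDiff ℝ 1 F) : Continuous (diverg F) :=
  (LinearMap.continuous_of_finiteDimensional
    ((LinearMap.trace ℝ (EuclideanSpace ℝ (Fin n))).comp
      (ContinuousLinearMap.coeLM ℝ))).comp (hF.continuous_fderiv one_ne_zero)

theorem IsZnPeriodic.setIntegral_cube_diverg {n : ℕ}
    {F : EuclideanSpace ℝ (Fin n) → EuclideanSpace ℝ (Fin n)} (hF : IsZnPeriodic F)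
    (hFc : ContDiff ℝ 1 F) : ∫ x in cube n, diverg F x = 0 := by
  have hFi : ∀ i, ContDiff ℝ 1 fun y => F y i := fun i =>
    (EuclideanSpace.proj i : EuclideanSpace ℝ (Fin n) →L[ℝ] ℝ).contDiff.comp hFc
  simp only [diverg_eq_sum _ (hFc.differentiable one_ne_zero _)]
  rw [integral_finsetSum]
  · refine Finset.sum_eq_zero fun i _ => IsZnPeriodic.setIntegral_cube_fderiv_apply ?_ (hFi i) i
    intro x z
    simp only [hF x z]
  · intro i _
    have := (hFi i).continuous_fderiv one_ne_zero
    exact integrableOn_cube (by fun_prop)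

theorem diverg_smul {n : ℕ} {f : EuclideanSpace ℝ (Fin n) → ℝ}
    {F : EuclideanSpace ℝ (Fin n) → EuclideanSpace ℝ (Fin n)} {x : EuclideanSpace ℝ (Fin n)}
    (hf : DifferentiableAt ℝ f x) (hF : DifferentiableAt ℝ F x) :
    diverg (fun y => f y • F y) x = f x * diverg F x + ⟪F x, gradient f x⟫ := by
  have h := fderiv_fun_smul hf hF
  rw [real_inner_comm, inner_gradient_left]
  simp only [diverg]
  rw [h]
  simp

theorem gradient_sub {n : ℕ} {f g : EuclideanSpace ℝ (Fin n) → ℝ} {x : EuclideanSpace ℝ (Fin n)}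
    (hf : DifferentiableAt ℝ f x) (hg : DifferentiableAt ℝ g x) :
    gradient (fun y => f y - g y) x = gradient f x - gradient g x := by
  simp only [gradient, fderiv_fun_sub hf hg, map_sub]

theorem ContDiff.gradient {n : ℕ} {f : EuclideanSpace ℝ (Fin n) → ℝ}
    (hf : ContDiff ℝ 2 f) : ContDiff ℝ 1 (gradient f) :=
  (InnerProductSpace.toDual ℝ (EuclideanSpace ℝ (Fin n))).symm.contDiff.comp
    (hf.fderiv_right (m := 1) (by norm_num))

theorem laplacian_sub {n : ℕ} {f g : EuclideanSpace ℝ (Fin n) → ℝ} (hf : ContDiff ℝ 2 f)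
    (hg : ContDiff ℝ 2 g) (x : EuclideanSpace ℝ (Fin n)) :
    laplacian (fun y => f y - g y) x = laplacian f x - laplacian g x := by
  have h : gradient (fun y => f y - g y) = fun y => gradient f y - gradient g y := by
    funext y
    exact gradient_sub (hf.differentiable two_ne_zero y) (hg.differentiable two_ne_zero y)
  rw [laplacian, laplacian, laplacian, h, diverg, diverg, diverg,
    fderiv_fun_sub (hf.gradient.differentiable one_ne_zero x)
      (hg.gradient.differentiable one_ne_zero x)]
  simp

/-! ### A Poincaré inequality for periodic functions -/

theorem setIntegral_cube_norm_sub_half_sq (n : ℕ) :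
    ∫ h in cube n, ‖(WithLp.toLp 2 fun _ => -(1 / 2 : ℝ)) + h‖ ^ 2 = n / 12 := by
  have hcoord : ∀ i : Fin n, ∫ h in cube n, (h i - 1 / 2) ^ 2 = (1 / 12 : ℝ) := by
    intro i
    have h1 := setIntegral_cube_comp_ofLp (n := n) fun y => (y i - 1 / 2) ^ 2
    have h2 : (volume : Measure (Fin n → ℝ)).restrict (Set.Icc 0 1) =
        Measure.pi fun _ => volume.restrict (Set.Icc (0 : ℝ) 1) := by
      rw [← Set.pi_univ_Icc]
      exact Measure.restrict_pi_pi _ _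
    have : IsProbabilityMeasure (volume.restrict (Set.Icc (0 : ℝ) 1)) := ⟨by simp⟩
    have h3 := measurePreserving_eval (fun _ : Fin n => volume.restrict (Set.Icc (0 : ℝ) 1)) i
    have h4 := integral_map (f := fun t : ℝ => (t - 1 / 2) ^ 2) h3.aemeasurable
      (by rw [h3.map_eq]; exact Continuous.aestronglyMeasurable (by fun_prop))
    rw [h3.map_eq, integral_Icc_eq_integral_Ioc,
      ← intervalIntegral.integral_of_le zero_le_one,
      intervalIntegral.integral_comp_sub_right (fun t => t ^ 2), integral_pow] at h4
    rw [h2] at h1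
    refine h1.trans (h4.symm.trans ?_)
    norm_num
  have hexp : ∀ h : EuclideanSpace ℝ (Fin n),
      ‖(WithLp.toLp 2 fun _ => -(1 / 2 : ℝ)) + h‖ ^ 2 = ∑ i, (h i - 1 / 2) ^ 2 := by
    intro h
    rw [EuclideanSpace.real_norm_sq_eq]
    refine Finset.sum_congr rfl fun i _ => ?_
    simp
    ring
  simp only [hexp]
  rw [integral_finsetSum]
  · simp only [hcoord, Finset.sum_const, Finset.card_univ, Fintype.card_fin, nsmul_eq_mul]
    ring
  · exact fun i _ => integrableOn_cube (by fun_prop)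

theorem sq_setIntegral_Icc_le {a : ℝ → ℝ} (ha : Continuous a) :
    (∫ s in Set.Icc (0 : ℝ) 1, a s) ^ 2 ≤ ∫ s in Set.Icc (0 : ℝ) 1, a s ^ 2 := by
  set m := ∫ s in Set.Icc (0 : ℝ) 1, a s with hm
  have hi : ∀ {g : ℝ → ℝ}, Continuous g → IntegrableOn g (Set.Icc (0 : ℝ) 1) :=
    fun hg => hg.continuousOn.integrableOn_compact isCompact_Icc
  have h0 : 0 ≤ ∫ s in Set.Icc (0 : ℝ) 1, (a s - m) ^ 2 :=
    integral_nonneg fun s => sq_nonneg _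
  have h1 : ∫ s in Set.Icc (0 : ℝ) 1, (a s - m) ^ 2 =
      (∫ s in Set.Icc (0 : ℝ) 1, a s ^ 2) - 2 * m * m + m ^ 2 := by
    have : ∀ s, (a s - m) ^ 2 = a s ^ 2 - 2 * m * a s + m ^ 2 := fun s => by ring
    simp only [this]
    rw [integral_add, integral_sub, integral_const_mul, ← hm]
    · simp
    · exact hi (by fun_prop)
    · exact hi (by fun_prop)
    · exact hi (by fun_prop)
    · exact hi (by fun_prop)
  nlinarith

theorem IsZnPeriodic.setIntegral_cube_translate_sub_sq_le {n : ℕ}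
    {f : EuclideanSpace ℝ (Fin n) → ℝ} (hf : IsZnPeriodic f) (hfc : ContDiff ℝ 1 f)
    (v : EuclideanSpace ℝ (Fin n)) :
    ∫ x in cube n, (f (x + v) - f x) ^ 2 ≤
      ‖v‖ ^ 2 * ∫ x in cube n, ‖_root_.gradient f x‖ ^ 2 := by
  have hfd := hfc.continuous_fderiv one_ne_zero
  have hf0 := hfc.continuous
  have hnorm : ∀ x, ‖_root_.gradient f x‖ = ‖_root_.fderiv ℝ f x‖ := fun x => by
    simp [_root_.gradient]
  have hper : IsZnPeriodic fun x => (_root_.fderiv ℝ f x v) ^ 2 := fun x z => by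
    simp only [hf.fderiv x z]
  calc ∫ x in cube n, (f (x + v) - f x) ^ 2
      ≤ ∫ x in cube n, ∫ s in Set.Icc (0 : ℝ) 1, (_root_.fderiv ℝ f (s • v + x) v) ^ 2 := by
        refine setIntegral_mono (integrableOn_cube (by fun_prop)) (integrableOn_cube ?_)
          fun x => ?_
        · exact continuous_parametric_integral_of_continuous
            (by simp only [Function.uncurry_def]; fun_prop) isCompact_Icc
        · dsimp only
          rw [sub_eq_setIntegral_fderiv hfc]
          exact sq_setIntegral_Icc_le (by fun_prop)
    _ = ∫ s in Set.Icc (0 : ℝ) 1, ∫ x in cube n, (_root_.fderiv ℝ f (s • v + x) v) ^ 2 :=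
        setIntegral_setIntegral_swap_of_isCompact (isCompact_cube n) isCompact_Icc
          (by simp only [Function.uncurry_def]; fun_prop)
    _ = ∫ x in cube n, (_root_.fderiv ℝ f x v) ^ 2 := by
        simp only [hper.setIntegral_cube_add]
        simp
    _ ≤ ∫ x in cube n, ‖v‖ ^ 2 * ‖_root_.gradient f x‖ ^ 2 := by
        simp only [hnorm]
        refine setIntegral_mono (integrableOn_cube (by fun_prop))
          (integrableOn_cube (by fun_prop)) fun x => ?_
        dsimp only
        rw [← mul_pow, ← sq_abs, mul_comm]
        exact pow_le_pow_left₀ (abs_nonneg _) ((_root_.fderiv ℝ f x).le_opNorm v) 2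
    _ = _ := integral_const_mul _ _

/-- A Poincaré inequality obtained by averaging the difference quotients of `f` over all
translations by vectors of `[-1/2, 1/2]ⁿ`. -/
theorem IsZnPeriodic.poincare {n : ℕ} {f : EuclideanSpace ℝ (Fin n) → ℝ} (hf : IsZnPeriodic f)
    (hfc : ContDiff ℝ 1 f) (hmean : ∫ x in cube n, f x = 0) :
    ∫ x in cube n, f x ^ 2 ≤ n / 24 * ∫ x in cube n, ‖_root_.gradient f x‖ ^ 2 := by
  have hf0 := hfc.continuous
  set c : EuclideanSpace ℝ (Fin n) := WithLp.toLp 2 fun _ => -(1 / 2 : ℝ) with hc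
  set E := ∫ x in cube n, ‖_root_.gradient f x‖ ^ 2 with hE
  set W := ∫ x in cube n, f x ^ 2 with hW
  have hsq : IsZnPeriodic fun x => f x ^ 2 := fun x z => by simp only [hf x z]
  have hmean_translate : ∀ x, ∫ h in cube n, f (x + (c + h)) = 0 := by
    intro x
    simp only [← add_assoc]
    rw [hf.setIntegral_cube_add, hmean]
  have hlower : ∫ h in cube n, ∫ x in cube n, (f (x + (c + h)) - f x) ^ 2 = 2 * W := by
    have hinner : ∀ h, ∫ x in cube n, (f (x + (c + h)) - f x) ^ 2 =
        2 * W - 2 * ∫ x in cube n, f x * f (x + (c + h)) := by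
      intro h
      have hexp : ∀ x, (f (x + (c + h)) - f x) ^ 2 =
          f ((c + h) + x) ^ 2 + f x ^ 2 - 2 * (f x * f (x + (c + h))) := by
        intro x
        rw [add_comm (c + h) x]
        ring
      simp only [hexp]
      rw [integral_sub, integral_add, integral_const_mul, hsq.setIntegral_cube_add]
      · ring
      all_goals exact integrableOn_cube (by fun_prop)
    simp only [hinner]
    rw [integral_sub, integral_const_mul (2 : ℝ) fun h => ∫ x in cube n, f x * f (x + (c + h)),
      setIntegral_cube_const,
      setIntegral_setIntegral_swap_of_isCompact (isCompact_cube n) (isCompact_cube n)]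
    · simp only [integral_const_mul, hmean_translate]
      simp
    · simp only [Function.uncurry_def]
      fun_prop
    · exact integrableOn_cube continuous_const
    · refine integrableOn_cube (continuous_const.mul (continuous_setIntegral_cube ?_))
      simp only [Function.uncurry_def]
      fun_prop
  have hupper : ∫ h in cube n, ∫ x in cube n, (f (x + (c + h)) - f x) ^ 2 ≤ n / 12 * E := by
    rw [← setIntegral_cube_norm_sub_half_sq, ← integral_mul_const]
    refine setIntegral_mono (integrableOn_cube (continuous_setIntegral_cube ?_))
      (integrableOn_cube (by fun_prop))
      fun h => hf.setIntegral_cube_translate_sub_sq_le hfc (c + h)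
    simp only [Function.uncurry_def]
    fun_prop
  linarith

/-! ### The energy estimate -/

theorem setIntegral_cube_energy_identity {n : ℕ} {κ : ℝ}
    {V : EuclideanSpace ℝ (Fin n) → EuclideanSpace ℝ (Fin n)} {w : EuclideanSpace ℝ (Fin n) → ℝ}
    (hV : ContDiff ℝ 1 V) (hVper : IsZnPeriodic V) (hVdiv : ∀ x, diverg V x = 0)
    (hw : ContDiff ℝ 2 w) (hwper : IsZnPeriodic w) :
    ∫ x in cube n, w x * (-κ * laplacian w x + ⟪V x, gradient w x⟫) =
      κ * ∫ x in cube n, ‖gradient w x‖ ^ 2 := by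
  have hw1 : ContDiff ℝ 1 w := hw.of_le (by norm_num)
  have hg := hw.gradient
  have hgc := hg.continuous
  have hdw := hw1.differentiable one_ne_zero
  have hdV := hV.differentiable one_ne_zero
  have hdiff : ContDiff ℝ 1 fun x => w x • gradient w x := hw1.smul hg
  have htrans : ContDiff ℝ 1 fun x => w x • w x • V x := hw1.smul (hw1.smul hV)
  have hdiff_zero : ∫ x in cube n, diverg (fun x => w x • gradient w x) x = 0 :=
    IsZnPeriodic.setIntegral_cube_diverg
      (fun x z => by simp only [hwper x z, hwper.gradient x z]) hdiff
  have htrans_zero : ∫ x in cube n, diverg (fun x => w x • w x • V x) x = 0 :=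
    IsZnPeriodic.setIntegral_cube_diverg
      (fun x z => by simp only [hwper x z, hVper x z]) htrans
  have hpt : ∀ x, w x * (-κ * laplacian w x + ⟪V x, gradient w x⟫) =
      κ * ‖gradient w x‖ ^ 2 - κ * diverg (fun x => w x • gradient w x) x +
        1 / 2 * diverg (fun x => w x • w x • V x) x := by
    intro x
    rw [diverg_smul (hdw x) (hg.differentiable one_ne_zero x),
      diverg_smul (hdw x) ((hdw x).fun_smul (hdV x)), diverg_smul (hdw x) (hdV x), hVdiv x,
      real_inner_self_eq_norm_sq, real_inner_smul_left, laplacian]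
    ring
  have hc1 := continuous_diverg hdiff
  have hc2 := continuous_diverg htrans
  simp only [hpt]
  rw [integral_add, integral_sub, integral_const_mul, integral_const_mul, integral_const_mul,
    hdiff_zero, htrans_zero]
  · ring
  all_goals exact integrableOn_cube (by fun_prop)

/-- One-step contraction estimate for the iteration scheme of the cell problem of the
viscous G-equation (proof of Theorem B.1 of the paper). -/
theorem iteration_scheme_one_step_contraction
    (n : ℕ) (hn : 1 ≤ n) (sL d : ℝ) (hsL : 0 < sL) (hd : 0 < d)
    (V : EuclideanSpace ℝ (Fin n) → EuclideanSpace ℝ (Fin n))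
    (hVsmooth : ContDiff ℝ (⊤:ℕ∞) V) (hVper : IsZnPeriodic V)
    (hVdiv : ∀ x, diverg V x = 0)
    (P : EuclideanSpace ℝ (Fin n))
    (u₁ u₂ w₁ w₂ : EuclideanSpace ℝ (Fin n) → ℝ)
    (hu₁ : ContDiff ℝ (⊤:ℕ∞) u₁) (hu₂ : ContDiff ℝ (⊤:ℕ∞) u₂)
    (hw₁ : ContDiff ℝ (⊤:ℕ∞) w₁) (hw₂ : ContDiff ℝ (⊤:ℕ∞) w₂)
    (hu₁per : IsZnPeriodic u₁) (hu₂per : IsZnPeriodic u₂)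
    (hw₁per : IsZnPeriodic w₁) (hw₂per : IsZnPeriodic w₂)
    (hw₁mean : ∫ x in cube n, w₁ x = 0) (hw₂mean : ∫ x in cube n, w₂ x = 0)
    (H₁ H₂ : ℝ)
    (heq₁ : ∀ x, -(d * sL) * laplacian w₁ x + ⟪V x, gradient w₁ x⟫
        = H₁ - sL * ‖P + gradient u₁ x‖ - ⟪V x, P⟫)
    (heq₂ : ∀ x, -(d * sL) * laplacian w₂ x + ⟪V x, gradient w₂ x⟫
        = H₂ - sL * ‖P + gradient u₂ x‖ - ⟪V x, P⟫) :
    Real.sqrt (∫ x in cube n, ‖gradient w₁ x - gradient w₂ x‖^2)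
      ≤ (Real.sqrt n / (Real.pi * d)) *
        Real.sqrt (∫ x in cube n, ‖gradient u₁ x - gradient u₂ x‖^2) := by
  have hle : ((2 : ℕ∞) : WithTop ℕ∞) ≤ ((⊤ : ℕ∞) : WithTop ℕ∞) := by exact_mod_cast le_top
  replace hw₁ : ContDiff ℝ 2 w₁ := hw₁.of_le hle
  replace hw₂ : ContDiff ℝ 2 w₂ := hw₂.of_le hle
  have hg₁ : Continuous (gradient u₁) := (hu₁.of_le hle).gradient.continuous
  have hg₂ : Continuous (gradient u₂) := (hu₂.of_le hle).gradient.continuous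
  set w : EuclideanSpace ℝ (Fin n) → ℝ := fun x => w₁ x - w₂ x with hwdef
  have hw : ContDiff ℝ 2 w := hw₁.sub hw₂
  have hwc : Continuous w := hw.continuous
  have hwper : IsZnPeriodic w := fun x z => by simp only [hwdef, hw₁per x z, hw₂per x z]
  have hwmean : ∫ x in cube n, w x = 0 := by
    simp only [hwdef]
    rw [integral_sub (integrableOn_cube hw₁.continuous) (integrableOn_cube hw₂.continuous),
      hw₁mean, hw₂mean, sub_zero]
  have hgrad : ∀ x, gradient w x = gradient w₁ x - gradient w₂ x := fun x =>
    gradient_sub (hw₁.differentiable two_ne_zero x) (hw₂.differentiable two_ne_zero x)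
  simp only [← hgrad]
  set E := ∫ x in cube n, ‖gradient w x‖ ^ 2 with hE
  set U := ∫ x in cube n, ‖gradient u₁ x - gradient u₂ x‖ ^ 2 with hU
  have hU0 : 0 ≤ U := integral_nonneg fun x => by positivity
  have hn0 : (0 : ℝ) < n := by exact_mod_cast hn
  have hpde : ∀ x, w x * (-(d * sL) * laplacian w x + ⟪V x, gradient w x⟫) =
      (H₁ - H₂) * w x - sL * (w x * (‖P + gradient u₁ x‖ - ‖P + gradient u₂ x‖)) := by
    intro x
    rw [laplacian_sub hw₁ hw₂, hgrad, inner_sub_right]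
    linear_combination w x * (heq₁ x - heq₂ x)
  have henergy : d * E = -∫ x in cube n, w x * (‖P + gradient u₁ x‖ - ‖P + gradient u₂ x‖) := by
    have h := setIntegral_cube_energy_identity (κ := d * sL)
      (hVsmooth.of_le (by exact_mod_cast le_top)) hVper hVdiv hw hwper
    simp only [hpde] at h
    rw [integral_sub (integrableOn_cube (by fun_prop)) (integrableOn_cube (by fun_prop)),
      integral_const_mul, integral_const_mul, hwmean] at h
    refine mul_left_cancel₀ hsL.ne' ?_
    linear_combination -h
  have hyoung : d * E ≤ 12 * d / n * (∫ x in cube n, w x ^ 2) + n / (48 * d) * U := by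
    rw [henergy, ← integral_neg, ← integral_const_mul, ← integral_const_mul,
      ← integral_add (integrableOn_cube (by fun_prop)) (integrableOn_cube (by fun_prop))]
    refine setIntegral_mono (integrableOn_cube (by fun_prop)) (integrableOn_cube (by fun_prop))
      fun x => ?_
    dsimp only
    have hlip : |‖P + gradient u₁ x‖ - ‖P + gradient u₂ x‖| ≤
        ‖gradient u₁ x - gradient u₂ x‖ := by
      simpa using abs_norm_sub_norm_le (P + gradient u₁ x) (P + gradient u₂ x)
    have hsq := pow_le_pow_left₀ (abs_nonneg _) hlip 2
    rw [sq_abs] at hsq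
    set g := ‖P + gradient u₁ x‖ - ‖P + gradient u₂ x‖
    have hfac : -(w x * g) ≤ 12 * d / n * w x ^ 2 + n / (48 * d) * g ^ 2 := by
      have : 12 * d / n * w x ^ 2 + n / (48 * d) * g ^ 2 + w x * g =
          12 * d / n * (w x + n / (24 * d) * g) ^ 2 := by
        field_simp
        ring
      have : 0 ≤ 12 * d / n * (w x + n / (24 * d) * g) ^ 2 := by positivity
      linarith
    have : n / (48 * d) * g ^ 2 ≤ n / (48 * d) * ‖gradient u₁ x - gradient u₂ x‖ ^ 2 := by
      gcongr
    linarith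
  have hpoincare := hwper.poincare (hw.of_le (by norm_num)) hwmean
  have hbound : E ≤ n / (24 * d ^ 2) * U := by
    have h1 : 12 * d / n * (∫ x in cube n, w x ^ 2) ≤ d / 2 * E := by
      calc 12 * d / n * (∫ x in cube n, w x ^ 2) ≤ 12 * d / n * (n / 24 * E) := by gcongr
        _ = d / 2 * E := by
          field_simp
          ring
    have h2 : d / 2 * E ≤ d / 2 * (n / (24 * d ^ 2) * U) := by
      have : d / 2 * (n / (24 * d ^ 2) * U) = n / (48 * d) * U := by
        field_simp
        ring
      linarith
    exact le_of_mul_le_mul_left h2 (by positivity)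
  have hpi : Real.pi ^ 2 ≤ 24 := by nlinarith [Real.pi_lt_four, Real.pi_pos, Real.pi_lt_d2]
  have hconst : √(n : ℝ) / (Real.pi * d) * √U = √(n / (Real.pi ^ 2 * d ^ 2) * U) := by
    rw [Real.sqrt_mul (by positivity), Real.sqrt_div (Nat.cast_nonneg n), ← mul_pow,
      Real.sqrt_sq (by positivity)]
  rw [hconst]
  refine Real.sqrt_le_sqrt (hbound.trans ?_)
  gcongr

end
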